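/- arXiv:0809.0476 — 3 statements merged into one kernel-verified Lean document; each statement's English description precedes it below -/
import Mathlib

section
/- Let S be a numerical semigroup with multiplicity e = a_1 and Frobenius number f. Then δ ≤ γ ≤ ord(C) ≤ τ ≤ g(a_1) ≤ r, where ord(C) = min{ord(f+1), ord(f+2), …, ord(f+a_1)}. -/
namespace GotoNS

/-- `S` is a numerical semigroup: an additive submonoid of `ℕ` with finite
complement, different from `ℕ` itself. -/
def IsNumericalSemigroup (S : Set ℕ) : Prop :=
  (0 : ℕ) ∈ S ∧ (∀ a b, a ∈ S → b ∈ S → a + b ∈ S) ∧ Sᶜ.Finite ∧ S ≠ Set.univ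

/-- The multiplicity `e` of `S`: its smallest nonzero element. -/
noncomputable def mult (S : Set ℕ) : ℕ := sInf {n | n ∈ S ∧ n ≠ 0}

/-- The Frobenius number `f` of `S`: the largest integer not in `S`. -/
noncomputable def frob (S : Set ℕ) : ℕ := sSup {n | n ∉ S}

/-- The `k`-fold sumset `kM` of `M = S \ {0}` (with `0M = {0}`). -/
def kfold (S : Set ℕ) (k : ℕ) : Set ℕ :=
  {s | ∃ c : Fin k → ℕ, (∀ i, c i ∈ S ∧ c i ≠ 0) ∧ ∑ i, c i = s}

/-- The order of `s`: the largest `k` such that `s` is a sum of `k` nonzero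
elements of `S` (`ord 0 = 0`; junk value `0` off `S`). -/
noncomputable def ordS (S : Set ℕ) (s : ℕ) : ℕ := sSup {k | s ∈ kfold S k}

/-- The Apéry set `Ap(S; n) = {w ∈ S | w - n ∉ S}`. -/
def apery (S : Set ℕ) (n : ℕ) : Set ℕ := {w | w ∈ S ∧ ∀ s ∈ S, s + n ≠ w}

/-- `σ(α) = max {ord w | w ∈ Ap(S; α)}`. -/
noncomputable def sigmaS (S : Set ℕ) (α : ℕ) : ℕ := sSup (ordS S '' apery S α)

/-- `𝒜(u) = {α ∈ {1, …, e} | u - α ∈ S}`. -/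
def Aset (S : Set ℕ) (u : ℕ) : Set ℕ :=
  {α | 1 ≤ α ∧ α ≤ mult S ∧ ∃ s ∈ S, s + α = u}

/-- The Goto number `g(u) = min {σ(α) | α ∈ 𝒜(u)}`. -/
noncomputable def goto (S : Set ℕ) (u : ℕ) : ℕ := sInf (sigmaS S '' Aset S u)

/-- `τ`: the minimal Goto number of a nonzero element of `S`. -/
noncomputable def tau (S : Set ℕ) : ℕ := sInf (goto S '' {u | u ∈ S ∧ u ≠ 0})

/-- `ρ`: the maximal Goto number of a nonzero element of `S`. -/
noncomputable def rho (S : Set ℕ) : ℕ := sSup (goto S '' {u | u ∈ S ∧ u ≠ 0})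

/-- An integer belongs to `S` (viewed inside `ℤ`). -/
def memZ (S : Set ℕ) (z : ℤ) : Prop := ∃ n : ℕ, n ∈ S ∧ (n : ℤ) = z

/-- `T = {z ∈ ℤ \ S | z + u ∈ S for all 0 ≠ u ∈ S}`. -/
def Tset (S : Set ℕ) : Set ℤ :=
  {z | ¬ memZ S z ∧ ∀ u : ℕ, u ∈ S → u ≠ 0 → memZ S (z + (u : ℤ))}

open Classical in
/-- The order of an integer, with the convention `ord z = -1` if `z ∉ S`. -/
noncomputable def ordZ (S : Set ℕ) (z : ℤ) : ℤ :=
  if 0 ≤ z ∧ z.toNat ∈ S then (ordS S z.toNat : ℤ) else -1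

/-- `S` is symmetric: for integers `x + y = f`, exactly one of `x, y` lies in `S`. -/
def IsSymmetricNS (S : Set ℕ) : Prop :=
  ∀ x y : ℤ, x + y = (frob S : ℤ) → (memZ S x ↔ ¬ memZ S y)

/-- `u ⪯ u'` iff `u' - u ∈ S`. -/
def preceq (S : Set ℕ) (u u' : ℕ) : Prop := ∃ s ∈ S, u + s = u'

/-- `u ⪯_M u'` iff `u + s = u'` and `ord u + ord s = ord u'` for some `s ∈ S`. -/
def preceqM (S : Set ℕ) (u u' : ℕ) : Prop :=
  ∃ s ∈ S, u + s = u' ∧ ordS S u + ordS S s = ordS S u'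

/-- `Ap(S) \ {0}`. -/
def apNZ (S : Set ℕ) : Set ℕ := apery S (mult S) \ {0}

/-- Minimal elements of `Ap(S) \ {0}` with respect to `⪯`. -/
def minAp (S : Set ℕ) : Set ℕ := {w | w ∈ apNZ S ∧ ∀ w' ∈ apNZ S, preceq S w' w → w' = w}

/-- Maximal elements of `Ap(S) \ {0}` with respect to `⪯`. -/
def maxAp (S : Set ℕ) : Set ℕ := {w | w ∈ apNZ S ∧ ∀ w' ∈ apNZ S, preceq S w w' → w' = w}

/-- Minimal elements of `Ap(S) \ {0}` with respect to `⪯_M`. -/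
def minApM (S : Set ℕ) : Set ℕ := {w | w ∈ apNZ S ∧ ∀ w' ∈ apNZ S, preceqM S w' w → w' = w}

/-- Maximal elements of `Ap(S) \ {0}` with respect to `⪯_M`. -/
def maxApM (S : Set ℕ) : Set ℕ := {w | w ∈ apNZ S ∧ ∀ w' ∈ apNZ S, preceqM S w w' → w' = w}

/-- `S` is pure if all elements of `maxAp S` have the same order. -/
def IsPure (S : Set ℕ) : Prop := ∀ w ∈ maxAp S, ∀ w' ∈ maxAp S, ordS S w = ordS S w'

/-- `S` is `M`-pure if all elements of `maxApM S` have the same order. -/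
def IsMPure (S : Set ℕ) : Prop := ∀ w ∈ maxApM S, ∀ w' ∈ maxApM S, ordS S w = ordS S w'

/-- `S` is `M`-additive if `ord (u + a₁) = ord u + 1` for all `u ∈ S`. -/
def IsMAdditive (S : Set ℕ) : Prop := ∀ u ∈ S, ordS S (u + mult S) = ordS S u + 1

/-- The reduction number `r = min {k | (k+1)M = a₁ + kM}`. -/
noncomputable def redNum (S : Set ℕ) : ℕ :=
  sInf {k | kfold S (k + 1) = (fun x => mult S + x) '' kfold S k}

/-- The set of minimal generators of `S`: nonzero elements of `S` that are not
sums of two nonzero elements of `S`. -/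
def minGens (S : Set ℕ) : Set ℕ :=
  {a | a ∈ S ∧ a ≠ 0 ∧ ∀ x ∈ S, ∀ y ∈ S, x ≠ 0 → y ≠ 0 → x + y ≠ a}

/-- `δ_w = max {ord w + ord w' | w' ∈ S, w + w' ∈ Ap(S)}`. -/
noncomputable def deltaI (S : Set ℕ) (w : ℕ) : ℕ :=
  sSup ((fun w' => ordS S w + ordS S w') '' {w' | w' ∈ S ∧ w + w' ∈ apery S (mult S)})

/-- `δ = min {δ_w | w ∈ Ap(S)}`. -/
noncomputable def deltaNS (S : Set ℕ) : ℕ := sInf (deltaI S '' apery S (mult S))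

/-- `γ_w = max {ord w + ⌊w'/a₁⌋ | w' ∈ S, w + w' ∈ Ap(S)}`. -/
noncomputable def gammaI (S : Set ℕ) (w : ℕ) : ℕ :=
  sSup ((fun w' => ordS S w + w' / mult S) '' {w' | w' ∈ S ∧ w + w' ∈ apery S (mult S)})

/-- `γ = min {γ_w | w ∈ Ap(S)}`. -/
noncomputable def gammaNS (S : Set ℕ) : ℕ := sInf (gammaI S '' apery S (mult S))

/-- `ord(C) = min {ord (f+1), …, ord (f+a₁)}`. -/
noncomputable def ordC (S : Set ℕ) : ℕ :=
  sInf ((fun α => ordS S (frob S + α)) '' Set.Icc 1 (mult S))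


section kfold

variable {S : Set ℕ}

theorem mem_kfold_zero {x : ℕ} : x ∈ kfold S 0 ↔ x = 0 := by
  simp [kfold, eq_comm]

theorem mem_kfold_succ {k x : ℕ} :
    x ∈ kfold S (k + 1) ↔ ∃ a ∈ S, a ≠ 0 ∧ ∃ y ∈ kfold S k, a + y = x := by
  constructor
  · rintro ⟨c, hc, rfl⟩
    exact ⟨c 0, (hc 0).1, (hc 0).2, _, ⟨fun i => c i.succ, fun i => hc _, rfl⟩,
      (Fin.sum_univ_succ c).symm⟩
  · rintro ⟨a, ha, ha0, _, ⟨c, hc, rfl⟩, rfl⟩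
    refine ⟨Fin.cons a c, fun i => ?_, by simp [Fin.sum_univ_succ]⟩
    refine Fin.cases ?_ (fun j => ?_) i
    · exact ⟨ha, ha0⟩
    · simpa using hc j

theorem add_mem_kfold {m n x y : ℕ} (hx : x ∈ kfold S m) (hy : y ∈ kfold S n) :
    x + y ∈ kfold S (m + n) := by
  induction m generalizing x with
  | zero => simpa [mem_kfold_zero.1 hx] using hy
  | succ m ih =>
    obtain ⟨a, ha, ha0, z, hz, rfl⟩ := mem_kfold_succ.1 hx
    rw [Nat.add_right_comm]
    exact mem_kfold_succ.2 ⟨a, ha, ha0, z + y, ih hz, by ring⟩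

theorem exists_add_of_mem_kfold_add {m n x : ℕ} (hx : x ∈ kfold S (m + n)) :
    ∃ a ∈ kfold S m, ∃ b ∈ kfold S n, a + b = x := by
  induction m generalizing x with
  | zero => exact ⟨0, mem_kfold_zero.2 rfl, x, by simpa using hx, by simp⟩
  | succ m ih =>
    rw [Nat.add_right_comm] at hx
    obtain ⟨a, ha, ha0, z, hz, rfl⟩ := mem_kfold_succ.1 hx
    obtain ⟨b, hb, c, hc, rfl⟩ := ih hz
    exact ⟨a + b, mem_kfold_succ.2 ⟨a, ha, ha0, b, hb, rfl⟩, c, hc, by ring⟩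

theorem mem_kfold_one {x : ℕ} (hx : x ∈ S) (hx0 : x ≠ 0) : x ∈ kfold S 1 :=
  mem_kfold_succ.2 ⟨x, hx, hx0, 0, mem_kfold_zero.2 rfl, by simp⟩

theorem mul_mem_kfold {a : ℕ} (ha : a ∈ S) (ha0 : a ≠ 0) (n : ℕ) : n * a ∈ kfold S n := by
  induction n with
  | zero => simp [mem_kfold_zero]
  | succ n ih => exact mem_kfold_succ.2 ⟨a, ha, ha0, _, ih, by ring⟩

theorem sum_mem_kfold_card {c : ℕ → ℕ} (s : Finset ℕ) (hc : ∀ i ∈ s, c i ∈ S ∧ c i ≠ 0) :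
    ∑ i ∈ s, c i ∈ kfold S s.card := by
  induction s using Finset.induction_on with
  | empty => simp [mem_kfold_zero]
  | insert a s ha ih =>
    rw [Finset.sum_insert ha, Finset.card_insert_of_notMem ha]
    obtain ⟨h1, h2⟩ := hc a (Finset.mem_insert_self a s)
    exact mem_kfold_succ.2
      ⟨_, h1, h2, _, ih fun i hi => hc i (Finset.mem_insert_of_mem hi), rfl⟩

theorem kfold_subset (hS : IsNumericalSemigroup S) {k x : ℕ} (hx : x ∈ kfold S k) : x ∈ S := by
  induction k generalizing x with
  | zero => exact mem_kfold_zero.1 hx ▸ hS.1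
  | succ k ih =>
    obtain ⟨a, ha, -, y, hy, rfl⟩ := mem_kfold_succ.1 hx
    exact hS.2.1 _ _ ha (ih hy)

theorem kfold_anti (hS : IsNumericalSemigroup S) {k n x : ℕ} (hk : 1 ≤ k) (hkn : k ≤ n)
    (hx : x ∈ kfold S n) : x ∈ kfold S k := by
  obtain ⟨k, rfl⟩ := Nat.exists_eq_add_of_le' hk
  obtain ⟨m, rfl⟩ := Nat.exists_eq_add_of_le hkn
  rw [show k + 1 + m = k + m + 1 by ring] at hx
  obtain ⟨a, ha, ha0, y, hy, rfl⟩ := mem_kfold_succ.1 hx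
  obtain ⟨b, hb, c, hc, rfl⟩ := exists_add_of_mem_kfold_add hy
  exact mem_kfold_succ.2
    ⟨a + c, hS.2.1 _ _ ha (kfold_subset hS hc), by omega, b, hb, by ring⟩

end kfold

section invariants

variable {S : Set ℕ}

theorem bddAbove_compl (hS : IsNumericalSemigroup S) : BddAbove {n | n ∉ S} := hS.2.2.1.bddAbove

theorem frob_notMem (hS : IsNumericalSemigroup S) : frob S ∉ S :=
  Nat.sSup_mem ((Set.ne_univ_iff_exists_notMem S).1 hS.2.2.2) (bddAbove_compl hS)

theorem mem_of_frob_lt (hS : IsNumericalSemigroup S) {n : ℕ} (hn : frob S < n) : n ∈ S := by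
  by_contra h
  exact absurd (le_csSup (bddAbove_compl hS) h) (not_le.2 hn)

theorem mult_mem_and_ne_zero (hS : IsNumericalSemigroup S) : mult S ∈ S ∧ mult S ≠ 0 :=
  Nat.sInf_mem (s := {n | n ∈ S ∧ n ≠ 0})
    ⟨frob S + 1, mem_of_frob_lt hS (Nat.lt_succ_self _), Nat.succ_ne_zero _⟩

theorem mult_pos (hS : IsNumericalSemigroup S) : 0 < mult S :=
  Nat.pos_of_ne_zero (mult_mem_and_ne_zero hS).2

theorem mult_le {n : ℕ} (hn : n ∈ S) (hn0 : n ≠ 0) : mult S ≤ n := Nat.sInf_le ⟨hn, hn0⟩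

theorem mul_mult_mem (hS : IsNumericalSemigroup S) (k : ℕ) : k * mult S ∈ S :=
  kfold_subset hS (mul_mem_kfold (mult_mem_and_ne_zero hS).1 (mult_mem_and_ne_zero hS).2 k)

theorem two_le_mult (hS : IsNumericalSemigroup S) : 2 ≤ mult S := by
  by_contra h
  have h1 : mult S = 1 := by have := mult_pos hS; omega
  have h2 := mul_mult_mem hS (frob S)
  rw [h1, mul_one] at h2
  exact frob_notMem hS h2

theorem mul_mult_le_of_mem_kfold {k x : ℕ} (hx : x ∈ kfold S k) : k * mult S ≤ x := by
  induction k generalizing x with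
  | zero => simp
  | succ k ih =>
    obtain ⟨a, ha, ha0, y, hy, rfl⟩ := mem_kfold_succ.1 hx
    rw [add_mul, one_mul, add_comm]
    exact add_le_add (mult_le ha ha0) (ih hy)

theorem le_div_mult_of_mem_kfold (hS : IsNumericalSemigroup S) {k x : ℕ} (hx : x ∈ kfold S k) :
    k ≤ x / mult S :=
  (Nat.le_div_iff_mul_le (mult_pos hS)).2 (mul_mult_le_of_mem_kfold hx)

theorem le_ordS (hS : IsNumericalSemigroup S) {k x : ℕ} (hx : x ∈ kfold S k) : k ≤ ordS S x :=
  le_csSup ⟨x / mult S, fun _ h => le_div_mult_of_mem_kfold hS h⟩ hx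

theorem mem_kfold_ordS (hS : IsNumericalSemigroup S) {x : ℕ} (hx : x ∈ S) :
    x ∈ kfold S (ordS S x) := by
  refine Nat.sSup_mem (s := {k | x ∈ kfold S k}) ?_
    ⟨x / mult S, fun _ h => le_div_mult_of_mem_kfold hS h⟩
  rcases eq_or_ne x 0 with rfl | h
  · exact ⟨0, mem_kfold_zero.2 rfl⟩
  · exact ⟨1, mem_kfold_one hx h⟩

theorem ordS_le_div_mult (hS : IsNumericalSemigroup S) {x : ℕ} (hx : x ∈ S) :
    ordS S x ≤ x / mult S :=
  le_div_mult_of_mem_kfold hS (mem_kfold_ordS hS hx)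

theorem ordS_add_le_ordS_add_mul (hS : IsNumericalSemigroup S) {x : ℕ} (hx : x ∈ S) (k : ℕ) :
    ordS S x + k ≤ ordS S (x + k * mult S) :=
  le_ordS hS (add_mem_kfold (mem_kfold_ordS hS hx)
    (mul_mem_kfold (mult_mem_and_ne_zero hS).1 (mult_mem_and_ne_zero hS).2 k))

theorem le_frob_add_of_mem_apery (hS : IsNumericalSemigroup S) {n w : ℕ} (hw : w ∈ apery S n) :
    w ≤ frob S + n := by
  by_contra! h
  exact hw.2 (w - n) (mem_of_frob_lt hS (by omega)) (by omega)

theorem zero_mem_apery (hS : IsNumericalSemigroup S) : 0 ∈ apery S (mult S) :=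
  ⟨hS.1, fun s _ h => by have := mult_pos hS; omega⟩

theorem bddAbove_ordS_apery (hS : IsNumericalSemigroup S) (n : ℕ) :
    BddAbove (ordS S '' apery S n) := by
  refine ⟨frob S + n, ?_⟩
  rintro _ ⟨w, hw, rfl⟩
  exact ((ordS_le_div_mult hS hw.1).trans (Nat.div_le_self _ _)).trans
    (le_frob_add_of_mem_apery hS hw)

theorem exists_mem_apery_add_mul (hS : IsNumericalSemigroup S) {x : ℕ} (hx : x ∈ S) :
    ∃ w ∈ apery S (mult S), ∃ k, w + k * mult S = x := by
  induction x using Nat.strong_induction_on with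
  | _ x ih =>
    by_cases h : ∃ s ∈ S, s + mult S = x
    · obtain ⟨s, hs, rfl⟩ := h
      obtain ⟨w, hw, k, rfl⟩ := ih s (by have := mult_pos hS; omega) hs
      exact ⟨w, hw, k + 1, by ring⟩
    · push Not at h
      exact ⟨x, ⟨hx, h⟩, 0, by simp⟩

theorem deltaI_le_gammaI (hS : IsNumericalSemigroup S) {w : ℕ} (hw : w ∈ apery S (mult S)) :
    deltaI S w ≤ gammaI S w := by
  have hbdd : BddAbove ((fun w' => ordS S w + w' / mult S) ''
      {w' | w' ∈ S ∧ w + w' ∈ apery S (mult S)}) := by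
    refine ⟨ordS S w + (frob S + mult S), ?_⟩
    rintro _ ⟨v, ⟨-, hv⟩, rfl⟩
    have h1 := le_frob_add_of_mem_apery hS hv
    have h2 := Nat.div_le_self v (mult S)
    dsimp only
    omega
  refine csSup_le ⟨_, 0, ⟨hS.1, by simpa using hw⟩, rfl⟩ ?_
  rintro _ ⟨v, hv, rfl⟩
  exact (Nat.add_le_add_left (ordS_le_div_mult hS hv.1) _).trans (le_csSup hbdd ⟨v, hv, rfl⟩)

theorem deltaNS_le_gammaNS (hS : IsNumericalSemigroup S) : deltaNS S ≤ gammaNS S := by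
  refine le_csInf ⟨_, 0, zero_mem_apery hS, rfl⟩ ?_
  rintro _ ⟨w, hw, rfl⟩
  exact le_trans (Nat.sInf_le ⟨w, hw, rfl⟩) (deltaI_le_gammaI hS hw)

theorem gammaNS_le_ordC (hS : IsNumericalSemigroup S) : gammaNS S ≤ ordC S := by
  refine le_csInf ⟨_, 1, ⟨le_rfl, mult_pos hS⟩, rfl⟩ ?_
  rintro _ ⟨α, ⟨hα, -⟩, rfl⟩
  obtain ⟨w, hw, k, hk⟩ :=
    exists_mem_apery_add_mul hS (mem_of_frob_lt hS (show frob S < frob S + α by omega))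
  refine le_trans (Nat.sInf_le ⟨w, hw, rfl⟩) ?_
  refine csSup_le ⟨_, 0, ⟨hS.1, by simpa using hw⟩, rfl⟩ ?_
  rintro _ ⟨v, ⟨-, hv⟩, rfl⟩
  have h1 := le_frob_add_of_mem_apery hS hv
  have h2 : v / mult S ≤ k := by
    refine Nat.le_of_lt_succ ((Nat.div_lt_iff_lt_mul (mult_pos hS)).2 ?_)
    rw [Nat.succ_mul]
    omega
  dsimp only
  rw [← hk]
  exact (Nat.add_le_add_left h2 _).trans (ordS_add_le_ordS_add_mul hS hw.1 k)

theorem Aset_nonempty (hS : IsNumericalSemigroup S) {u : ℕ} (hu : u ≠ 0) :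
    (Aset S u).Nonempty := by
  have h1 := Nat.div_add_mod (u - 1) (mult S)
  have h2 := Nat.mod_lt (u - 1) (mult_pos hS)
  exact ⟨(u - 1) % mult S + 1, by omega, by omega, _, mul_mult_mem hS ((u - 1) / mult S),
    by rw [mul_comm]; omega⟩

theorem ordC_le_sigmaS (hS : IsNumericalSemigroup S) {α : ℕ} (hα : 1 ≤ α) (hα' : α ≤ mult S) :
    ordC S ≤ sigmaS S α := by
  refine le_trans (Nat.sInf_le ⟨α, ⟨hα, hα'⟩, rfl⟩)
    (le_csSup (bddAbove_ordS_apery hS α) ⟨frob S + α, ⟨?_, fun s hs h => ?_⟩, rfl⟩)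
  · exact mem_of_frob_lt hS (by omega)
  · exact frob_notMem hS (Nat.add_right_cancel h ▸ hs)

theorem ordC_le_tau (hS : IsNumericalSemigroup S) : ordC S ≤ tau S := by
  refine le_csInf ⟨_, mult S, mult_mem_and_ne_zero hS, rfl⟩ ?_
  rintro _ ⟨u, ⟨-, hu⟩, rfl⟩
  refine le_csInf ((Aset_nonempty hS hu).image _) ?_
  rintro _ ⟨α, ⟨h1, h2, -⟩, rfl⟩
  exact ordC_le_sigmaS hS h1 h2

theorem tau_le_goto {u : ℕ} (hu : u ∈ S) (hu0 : u ≠ 0) : tau S ≤ goto S u :=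
  Nat.sInf_le ⟨u, ⟨hu, hu0⟩, rfl⟩

/-- Among any `e` natural numbers, some nonempty block of consecutive ones has sum divisible
by `e`. -/
theorem exists_dvd_sum_Ico {e : ℕ} (he : 0 < e) (c : ℕ → ℕ) :
    ∃ i j, i < j ∧ j ≤ e ∧ e ∣ ∑ l ∈ Finset.Ico i j, c l := by
  have key : ∀ i j, i < j →
      (∑ l ∈ Finset.range i, c l) % e = (∑ l ∈ Finset.range j, c l) % e →
      e ∣ ∑ l ∈ Finset.Ico i j, c l := by
    intro i j hij h
    rw [← Finset.sum_range_add_sum_Ico _ hij.le] at h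
    simpa using (Nat.modEq_iff_dvd' (Nat.le_add_right _ _)).1 h
  obtain ⟨i, hi, j, hj, hne, h⟩ := Finset.exists_ne_map_eq_of_card_lt_of_maps_to
    (s := Finset.range (e + 1)) (t := Finset.range e) (by simp)
    (f := fun n => (∑ l ∈ Finset.range n, c l) % e)
    (fun n _ => by simpa using Nat.mod_lt _ he)
  simp only [Finset.mem_range] at hi hj
  rcases lt_or_gt_of_ne hne with hlt | hlt
  · exact ⟨i, j, hlt, by omega, key i j hlt h⟩
  · exact ⟨j, i, hlt, by omega, key j i hlt h.symm⟩

theorem kfold_mult_subset (hS : IsNumericalSemigroup S) {x : ℕ} (hx : x ∈ kfold S (mult S)) :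
    ∃ y ∈ kfold S (mult S - 1), mult S + y = x := by
  obtain ⟨c, hc, rfl⟩ := hx
  have he := two_le_mult hS
  obtain ⟨hm, hm0⟩ := mult_mem_and_ne_zero hS
  set d : ℕ → ℕ := fun i => if h : i < mult S then c ⟨i, h⟩ else mult S with hd
  have hdS : ∀ i, d i ∈ S ∧ d i ≠ 0 := by
    intro i
    by_cases h : i < mult S
    · simpa [hd, h] using hc ⟨i, h⟩
    · simpa [hd, h] using ⟨hm, hm0⟩
  have hsum : ∑ i, c i = ∑ i ∈ Finset.range (mult S), d i := by
    rw [Finset.sum_range]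
    simp [hd]
  obtain ⟨i, j, hij, hj, m, hdvd⟩ := exists_dvd_sum_Ico (mult_pos hS) d
  have h1 := sum_mem_kfold_card (S := S) (Finset.range i) fun l _ => hdS l
  have h2 := sum_mem_kfold_card (S := S) (Finset.Ico i j) fun l _ => hdS l
  have h3 := sum_mem_kfold_card (S := S) (Finset.Ico j (mult S)) fun l _ => hdS l
  rw [Finset.card_range] at h1
  rw [Nat.card_Ico] at h2 h3
  have hm' : j - i ≤ m := by
    have := le_div_mult_of_mem_kfold hS h2
    rwa [hdvd, Nat.mul_div_cancel_left _ (mult_pos hS)] at this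
  obtain ⟨m, rfl⟩ : ∃ m', m = m' + 1 := ⟨m - 1, by omega⟩
  refine ⟨_, kfold_anti hS (by omega) ?_
    (add_mem_kfold (add_mem_kfold h1 (mul_mem_kfold hm hm0 m)) h3), ?_⟩
  · omega
  · rw [hsum, ← Finset.sum_range_add_sum_Ico _ hj, ← Finset.sum_range_add_sum_Ico _ hij.le, hdvd]
    ring

theorem kfold_redNum (hS : IsNumericalSemigroup S) :
    kfold S (redNum S + 1) = (fun x => mult S + x) '' kfold S (redNum S) := by
  refine Nat.sInf_mem (s := {k | kfold S (k + 1) = (fun x => mult S + x) '' kfold S k})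
    ⟨mult S - 1, ?_⟩
  obtain ⟨hm, hm0⟩ := mult_mem_and_ne_zero hS
  refine Set.Subset.antisymm ?_ ?_
  · rw [Nat.sub_add_cancel (mult_pos hS)]
    exact fun x hx => kfold_mult_subset hS hx
  · rintro _ ⟨y, hy, rfl⟩
    exact mem_kfold_succ.2 ⟨_, hm, hm0, y, hy, rfl⟩

theorem sigmaS_mult_le_redNum (hS : IsNumericalSemigroup S) : sigmaS S (mult S) ≤ redNum S := by
  refine csSup_le ⟨_, 0, zero_mem_apery hS, rfl⟩ ?_
  rintro _ ⟨w, hw, rfl⟩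
  by_contra! h
  have hk := mem_kfold_ordS hS hw.1
  obtain ⟨n, hn⟩ := Nat.exists_eq_add_of_le (Nat.succ_le_of_lt h)
  rw [hn] at hk
  obtain ⟨a, ha, b, hb, hab⟩ := exists_add_of_mem_kfold_add hk
  rw [Nat.succ_eq_add_one, kfold_redNum hS] at ha
  obtain ⟨y, hy, rfl⟩ := ha
  exact hw.2 (y + b) (hS.2.1 _ _ (kfold_subset hS hy) (kfold_subset hS hb))
    (by dsimp only at hab; omega)

theorem goto_mult_le_redNum (hS : IsNumericalSemigroup S) : goto S (mult S) ≤ redNum S :=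
  le_trans (Nat.sInf_le ⟨mult S, ⟨mult_pos hS, le_rfl, 0, hS.1, by simp⟩, rfl⟩)
    (sigmaS_mult_le_redNum hS)

end invariants

/-- `δ ≤ γ ≤ ord(C) ≤ τ ≤ g(a₁) ≤ r`. -/
theorem statement15 (S : Set ℕ) (hS : IsNumericalSemigroup S) :
    deltaNS S ≤ gammaNS S ∧ gammaNS S ≤ ordC S ∧ ordC S ≤ tau S ∧
    tau S ≤ goto S (mult S) ∧ goto S (mult S) ≤ redNum S :=
  ⟨deltaNS_le_gammaNS hS, gammaNS_le_ordC hS, ordC_le_tau hS,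
    tau_le_goto (mult_mem_and_ne_zero hS).1 (mult_mem_and_ne_zero hS).2, goto_mult_le_redNum hS⟩

end GotoNS
end

section
/- Let S be a numerical semigroup with minimal generators a_1 < … < a_ν and Frobenius number f. If S is pure and ⌊a_2/a_1⌋ ≥ g(a_1) − 1, then γ = ord(C) = τ = g(a_1), where ord(C) = min{ord(f+1), ord(f+2), …, ord(f+a_1)}. -/
namespace GotoNS

namespace IsNumericalSemigroup

variable {S : Set ℕ}

lemma mult_le {s : ℕ} (hs : s ∈ S) (h0 : s ≠ 0) : mult S ≤ s :=
  Nat.sInf_le ⟨hs, h0⟩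

lemma bddAbove_compl (hS : IsNumericalSemigroup S) : BddAbove {n | n ∉ S} :=
  hS.2.2.1.bddAbove

lemma mem_of_frob_lt (hS : IsNumericalSemigroup S) {n : ℕ} (h : frob S < n) : n ∈ S := by
  by_contra hn
  exact absurd (le_csSup hS.bddAbove_compl hn) (not_le.2 h)

lemma frob_notMem (hS : IsNumericalSemigroup S) : frob S ∉ S := by
  have hne : {n | n ∉ S}.Nonempty := (Set.ne_univ_iff_exists_notMem S).1 hS.2.2.2
  exact Nat.sSup_mem hne hS.bddAbove_compl

lemma mult_mem_ne (hS : IsNumericalSemigroup S) : mult S ∈ S ∧ mult S ≠ 0 :=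
  Nat.sInf_mem (s := {n | n ∈ S ∧ n ≠ 0})
    ⟨frob S + 1, hS.mem_of_frob_lt (Nat.lt_succ_self _), by omega⟩

lemma mult_pos (hS : IsNumericalSemigroup S) : 0 < mult S :=
  Nat.pos_of_ne_zero hS.mult_mem_ne.2

lemma mul_mult_le_of_mem_kfold {s k : ℕ} (h : s ∈ kfold S k) : k * mult S ≤ s := by
  obtain ⟨c, hc, rfl⟩ := h
  simpa using Finset.card_nsmul_le_sum Finset.univ c (mult S)
    fun i _ => mult_le (hc i).1 (hc i).2

lemma bddAbove_kfold (hS : IsNumericalSemigroup S) (s : ℕ) : BddAbove {k | s ∈ kfold S k} :=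
  ⟨s, fun _ hk => (Nat.le_mul_of_pos_right _ hS.mult_pos).trans (mul_mult_le_of_mem_kfold hk)⟩

lemma le_ordS (hS : IsNumericalSemigroup S) {s k : ℕ} (h : s ∈ kfold S k) : k ≤ ordS S s :=
  le_csSup (hS.bddAbove_kfold s) h

lemma one_le_ordS (hS : IsNumericalSemigroup S) {s : ℕ} (hs : s ∈ S) (h0 : s ≠ 0) :
    1 ≤ ordS S s :=
  hS.le_ordS ⟨fun _ => s, fun _ => ⟨hs, h0⟩, by simp⟩

lemma mem_kfold_ordS (hS : IsNumericalSemigroup S) {s : ℕ} (hs : s ∈ S) :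
    s ∈ kfold S (ordS S s) := by
  refine Nat.sSup_mem (s := {k | s ∈ kfold S k}) ?_ (hS.bddAbove_kfold s)
  by_cases h0 : s = 0
  · exact ⟨0, Fin.elim0, fun i => i.elim0, by simp [h0]⟩
  · exact ⟨1, fun _ => s, fun _ => ⟨hs, h0⟩, by simp⟩

lemma add_mem_kfold {s t k l : ℕ} (hs : s ∈ kfold S k) (ht : t ∈ kfold S l) :
    s + t ∈ kfold S (k + l) := by
  obtain ⟨c, hc, rfl⟩ := hs
  obtain ⟨d, hd, rfl⟩ := ht
  refine ⟨Fin.append c d, fun i => ?_, by simp [Fin.sum_univ_add]⟩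
  refine Fin.addCases (fun i => ?_) (fun i => ?_) i
  · simpa using hc i
  · simpa using hd i

lemma mul_mult_mem_kfold (hS : IsNumericalSemigroup S) (k : ℕ) :
    k * mult S ∈ kfold S k :=
  ⟨fun _ => mult S, fun _ => hS.mult_mem_ne, by simp⟩

lemma ordS_add_le (hS : IsNumericalSemigroup S) {s t : ℕ} (hs : s ∈ S) (ht : t ∈ S) :
    ordS S s + ordS S t ≤ ordS S (s + t) :=
  hS.le_ordS (add_mem_kfold (hS.mem_kfold_ordS hs) (hS.mem_kfold_ordS ht))

lemma ordS_add_mul_mult_le (hS : IsNumericalSemigroup S) {s : ℕ} (hs : s ∈ S) (k : ℕ) :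
    ordS S s + k ≤ ordS S (s + k * mult S) :=
  hS.le_ordS (add_mem_kfold (hS.mem_kfold_ordS hs) (hS.mul_mult_mem_kfold k))

lemma le_of_mem_apery (hS : IsNumericalSemigroup S) {w n : ℕ} (hw : w ∈ apery S n) :
    w ≤ frob S + n := by
  by_contra! h
  exact hw.2 (w - n) (hS.mem_of_frob_lt (by omega)) (by omega)

lemma frob_add_mem_apery (hS : IsNumericalSemigroup S) {n : ℕ} (hn : 0 < n) :
    frob S + n ∈ apery S n := by
  refine ⟨hS.mem_of_frob_lt (by omega), fun s hs h => hS.frob_notMem ?_⟩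
  rwa [← Nat.add_right_cancel h]

lemma zero_mem_apery (hS : IsNumericalSemigroup S) : 0 ∈ apery S (mult S) :=
  ⟨hS.1, fun s _ h => by have := hS.mult_pos; omega⟩

lemma mem_apery_of_add_mem (hS : IsNumericalSemigroup S) {n w w' : ℕ} (hw : w ∈ S)
    (hw' : w' ∈ S) (h : w + w' ∈ apery S n) : w' ∈ apery S n :=
  ⟨hw', fun s hs e => h.2 (w + s) (hS.2.1 _ _ hw hs) (by omega)⟩

lemma exists_mem_apery_add_mul (hS : IsNumericalSemigroup S) {s : ℕ} (hs : s ∈ S) :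
    ∃ w ∈ apery S (mult S), ∃ k, s = w + k * mult S := by
  induction s using Nat.strong_induction_on with
  | _ s ih =>
    by_cases h : s ∈ apery S (mult S)
    · exact ⟨s, h, 0, by simp⟩
    · simp only [apery, Set.mem_ofPred_eq, not_and, not_forall, not_not] at h
      obtain ⟨t, ht, rfl⟩ := h hs
      obtain ⟨w, hw, k, hk⟩ := ih t (by have := hS.mult_pos; omega) ht
      exact ⟨w, hw, k + 1, by rw [hk]; ring⟩

lemma exists_minGens_add (hS : IsNumericalSemigroup S) {s : ℕ} (hs : s ∈ S) (h0 : s ≠ 0) :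
    ∃ m ∈ minGens S, ∃ t ∈ S, t + m = s := by
  induction s using Nat.strong_induction_on with
  | _ s ih =>
    by_cases h : s ∈ minGens S
    · exact ⟨s, h, 0, hS.1, by simp⟩
    · have : ∃ x ∈ S, ∃ y ∈ S, x ≠ 0 ∧ y ≠ 0 ∧ x + y = s := by
        by_contra! hc
        exact h ⟨hs, h0, hc⟩
      obtain ⟨x, hx, y, hy, hx0, hy0, rfl⟩ := this
      obtain ⟨m, hm, t, ht, rfl⟩ := ih x (by omega) hx hx0
      exact ⟨m, hm, t + y, hS.2.1 _ _ ht hy, by omega⟩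

lemma mult_mem_minGens (hS : IsNumericalSemigroup S) : mult S ∈ minGens S := by
  refine ⟨hS.mult_mem_ne.1, hS.mult_mem_ne.2, fun x hx y hy hx0 hy0 h => ?_⟩
  have := mult_le hx hx0
  omega

lemma frob_add_mult_mem_maxAp (hS : IsNumericalSemigroup S) : frob S + mult S ∈ maxAp S := by
  have hp := hS.mult_pos
  refine ⟨⟨hS.frob_add_mem_apery hp, by simp; omega⟩, ?_⟩
  rintro w' ⟨hw', -⟩ ⟨s, -, rfl⟩
  have := hS.le_of_mem_apery hw'
  omega

lemma ordS_le_of_isPure (hS : IsNumericalSemigroup S) (hpure : IsPure S) {w : ℕ}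
    (hw : w ∈ apNZ S) : ordS S w ≤ ordS S (frob S + mult S) := by
  induction hn : frob S + mult S - w using Nat.strong_induction_on generalizing w with
  | _ n ih =>
    by_cases hm : w ∈ maxAp S
    · exact (hpure _ hm _ hS.frob_add_mult_mem_maxAp).le
    · have : ∃ w' ∈ apNZ S, preceq S w w' ∧ w' ≠ w := by
        by_contra! hc
        exact hm ⟨hw, hc⟩
      obtain ⟨w', hw', ⟨s, hs, rfl⟩, hne⟩ := this
      have hle := hS.le_of_mem_apery hw'.1
      have h1 := hS.ordS_add_le hw.1.1 hs
      have h2 := ih _ (by omega) hw' rfl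
      omega

lemma bddAbove_ordS_apery (hS : IsNumericalSemigroup S) (n : ℕ) :
    BddAbove (ordS S '' apery S n) :=
  ((Set.finite_Iic (frob S + n)).subset fun _ hw => hS.le_of_mem_apery hw).image _ |>.bddAbove

lemma ordS_frob_add_le_sigmaS (hS : IsNumericalSemigroup S) {n : ℕ} (hn : 0 < n) :
    ordS S (frob S + n) ≤ sigmaS S n :=
  le_csSup (hS.bddAbove_ordS_apery n) ⟨_, hS.frob_add_mem_apery hn, rfl⟩

lemma ordS_zero (hS : IsNumericalSemigroup S) : ordS S 0 = 0 := by
  have h := mul_mult_le_of_mem_kfold (hS.mem_kfold_ordS hS.1)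
  have := hS.mult_pos
  simp_all
  omega

lemma sigmaS_mult_of_isPure (hS : IsNumericalSemigroup S) (hpure : IsPure S) :
    sigmaS S (mult S) = ordS S (frob S + mult S) := by
  refine le_antisymm (csSup_le ⟨_, 0, hS.zero_mem_apery, rfl⟩ ?_)
    (hS.ordS_frob_add_le_sigmaS hS.mult_pos)
  rintro _ ⟨w, hw, rfl⟩
  by_cases h0 : w = 0
  · simp [h0, hS.ordS_zero]
  · exact hS.ordS_le_of_isPure hpure ⟨hw, h0⟩

lemma Aset_mult (hS : IsNumericalSemigroup S) : Aset S (mult S) = {mult S} := by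
  have hp := hS.mult_pos
  ext n
  simp only [Aset, Set.mem_ofPred_eq, Set.mem_singleton_iff]
  constructor
  · rintro ⟨h1, -, s, hs, h⟩
    by_cases h0 : s = 0
    · omega
    · have := mult_le hs h0
      omega
  · rintro rfl
    exact ⟨hp, le_rfl, 0, hS.1, by simp⟩

lemma goto_mult (hS : IsNumericalSemigroup S) : goto S (mult S) = sigmaS S (mult S) := by
  simp [goto, hS.Aset_mult]

lemma Aset_nonempty (hS : IsNumericalSemigroup S) {u : ℕ} (h0 : u ≠ 0) :
    (Aset S u).Nonempty := by
  have hp := hS.mult_pos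
  have hmul : ∀ k, k * mult S ∈ S := by
    intro k
    induction k with
    | zero => simpa using hS.1
    | succ k ih => rw [add_mul, one_mul]; exact hS.2.1 _ _ ih hS.mult_mem_ne.1
  have h1 := Nat.div_add_mod' (u - 1) (mult S)
  have h2 := Nat.mod_lt (u - 1) hp
  exact ⟨(u - 1) % mult S + 1, by omega, by omega, _, hmul ((u - 1) / mult S), by omega⟩

lemma ordC_le_tau (hS : IsNumericalSemigroup S) : ordC S ≤ tau S := by
  refine le_csInf ⟨_, mult S, hS.mult_mem_ne, rfl⟩ ?_
  rintro _ ⟨u, ⟨hu, h0⟩, rfl⟩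
  refine le_csInf ((hS.Aset_nonempty h0).image _) ?_
  rintro _ ⟨n, ⟨hn, hn', -⟩, rfl⟩
  have h : ordC S ≤ ordS S (frob S + n) := Nat.sInf_le ⟨n, ⟨hn, hn'⟩, rfl⟩
  exact h.trans (hS.ordS_frob_add_le_sigmaS hn)

lemma tau_le_goto_mult (hS : IsNumericalSemigroup S) : tau S ≤ goto S (mult S) :=
  Nat.sInf_le ⟨_, hS.mult_mem_ne, rfl⟩

lemma gammaNS_le_ordC (hS : IsNumericalSemigroup S) : gammaNS S ≤ ordC S := by
  have hp := hS.mult_pos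
  refine le_csInf ⟨_, 1, ⟨le_rfl, hp⟩, rfl⟩ ?_
  rintro _ ⟨n, ⟨hn, -⟩, rfl⟩
  obtain ⟨w, hw, k, hk⟩ := hS.exists_mem_apery_add_mul (s := frob S + n)
    (hS.mem_of_frob_lt (by omega))
  have h : gammaNS S ≤ gammaI S w := Nat.sInf_le ⟨w, hw, rfl⟩
  refine h.trans (csSup_le ⟨_, 0, ⟨hS.1, hw⟩, rfl⟩ ?_)
  rintro _ ⟨w', ⟨-, h⟩, rfl⟩
  have hle := hS.le_of_mem_apery h
  have hlt : w' / mult S < k + 1 := (Nat.div_lt_iff_lt_mul hp).2 (by rw [add_mul]; omega)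
  have := hS.ordS_add_mul_mult_le hw.1 k
  simp only [hk]
  omega

lemma le_gammaI (hS : IsNumericalSemigroup S) {w w' : ℕ} (hw' : w' ∈ S)
    (h : w + w' ∈ apery S (mult S)) : ordS S w + w' / mult S ≤ gammaI S w := by
  refine le_csSup (Set.Finite.bddAbove (Set.Finite.image _ ?_)) ⟨w', ⟨hw', h⟩, rfl⟩
  refine (Set.finite_Iic (frob S + mult S)).subset fun v hv => ?_
  have := hS.le_of_mem_apery hv.2
  simp only [Set.mem_Iic]
  omega

lemma le_of_mem_apNZ (hS : IsNumericalSemigroup S) {ν : ℕ} {a : Fin ν → ℕ}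
    (ha : StrictMono a) (hgen : Set.range a = minGens S) (hν : 1 < ν) {w : ℕ}
    (hw : w ∈ apNZ S) : a ⟨1, hν⟩ ≤ w := by
  obtain ⟨m, hm, t, ht, rfl⟩ := hS.exists_minGens_add hw.1.1 hw.2
  obtain ⟨i, rfl⟩ := hgen ▸ hm
  obtain ⟨j, hj⟩ : mult S ∈ Set.range a := hgen ▸ hS.mult_mem_minGens
  have hij : i ≠ j := by
    rintro rfl
    exact hw.1.2 t ht (by rw [hj])
  have hji : j ≤ i := by
    rw [← ha.le_iff_le, hj]
    exact mult_le hm.1 hm.2.1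
  have : a ⟨1, hν⟩ ≤ a i := ha.monotone (Fin.le_def.2 (by
    have := Fin.val_ne_of_ne hij
    have := Fin.le_def.1 hji
    simp only
    omega))
  omega

end IsNumericalSemigroup

/-- if `S` is pure and `⌊a₂/a₁⌋ ≥ g(a₁) - 1`, then
`γ = ord(C) = τ = g(a₁)`. -/
theorem statement16 (S : Set ℕ) (hS : IsNumericalSemigroup S)
    (ν : ℕ) (a : Fin ν → ℕ) (ha : StrictMono a) (hgen : Set.range a = minGens S)
    (hν : 2 ≤ ν)
    (hpure : IsPure S) (hbig : goto S (mult S) - 1 ≤ a ⟨1, by omega⟩ / mult S) :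
    gammaNS S = goto S (mult S) ∧ ordC S = goto S (mult S) ∧ tau S = goto S (mult S) := by
  have hg : goto S (mult S) = ordS S (frob S + mult S) :=
    hS.goto_mult.trans (hS.sigmaS_mult_of_isPure hpure)
  have hp := hS.mult_pos
  have hmain : goto S (mult S) ≤ gammaNS S := by
    refine le_csInf ⟨_, 0, hS.zero_mem_apery, rfl⟩ ?_
    rintro _ ⟨w, hw, rfl⟩
    by_cases h0 : w = 0
    · subst h0
      have hF := hS.frob_add_mem_apery hp
      have h1 := hS.le_gammaI (w := 0) hF.1 (by simpa using hF)
      have h2 : goto S (mult S) ≤ (frob S + mult S) / mult S := by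
        rw [Nat.le_div_iff_mul_le hp, hg]
        exact IsNumericalSemigroup.mul_mult_le_of_mem_kfold (hS.mem_kfold_ordS hF.1)
      omega
    by_cases hm : w ∈ maxAp S
    · have h1 := hS.le_gammaI (w := w) hS.1 hw
      rwa [Nat.zero_div, add_zero, hpure _ hm _ hS.frob_add_mult_mem_maxAp, ← hg] at h1
    · have : ∃ w' ∈ apNZ S, preceq S w w' ∧ w' ≠ w := by
        by_contra! hc
        exact hm ⟨⟨hw, h0⟩, hc⟩
      obtain ⟨_, hw', ⟨s, hs, rfl⟩, hne⟩ := this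
      have h1 := hS.le_gammaI hs hw'.1
      have hs' : s ∈ apNZ S :=
        ⟨hS.mem_apery_of_add_mem hw.1 hs hw'.1, fun h => hne (by simp_all)⟩
      have h2 := Nat.div_le_div_right (c := mult S) (hS.le_of_mem_apNZ ha hgen hν hs')
      have h3 := hS.one_le_ordS hw.1 h0
      omega
  have h1 := hS.gammaNS_le_ordC
  have h2 := hS.ordC_le_tau
  have h3 := hS.tau_le_goto_mult
  omega

end GotoNS
end

section
/- Let S be the numerical semigroup generated by two coprime integers 2 ≤ a_1 < a_2 (so S has embedding dimension 2). Then: (1) g(k·a_2) = a_2 + k − 2 − ⌊k·a_2/a_1⌋ for every 1 ≤ k ≤ a_1 − 1; (2) g(u) = a_1 − 1 for every other nonzero u ∈ S; in particular τ = a_1 − 1. -/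
namespace GotoNS

section TwoGenerators

variable {a b : ℕ} {S : Set ℕ}

theorem exists_shift_of_eq (ha : 0 < a) (hcop : Nat.gcd a b = 1) {x y x' y' : ℕ} (hy : y' < a)
    (h : x * a + y * b = x' * a + y' * b) : ∃ t, y = y' + t * a ∧ x' = x + t * b := by
  have hmod : y * b ≡ y' * b [MOD a] := by
    have h' : (x * a + y * b) % a = (x' * a + y' * b) % a := by rw [h]
    simpa [Nat.ModEq, Nat.add_mod] using h'
  have hy' : y % a = y' := by
    have := Nat.ModEq.cancel_right_of_coprime hcop hmod
    rwa [Nat.ModEq, Nat.mod_eq_of_lt hy] at this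
  have hdiv := Nat.mod_add_div y a
  refine ⟨y / a, by rw [mul_comm (y / a), ← hy']; exact hdiv.symm, ?_⟩
  apply Nat.eq_of_mul_eq_mul_right ha
  rw [← hdiv, hy'] at h
  linarith

theorem exists_normal_form (ha : 0 < a) (hS : ∀ s, s ∈ S ↔ ∃ x y, x * a + y * b = s) {s : ℕ}
    (hs : s ∈ S) : ∃ x y, y < a ∧ x * a + y * b = s := by
  obtain ⟨x, y, rfl⟩ := (hS s).1 hs
  refine ⟨x + y / a * b, y % a, Nat.mod_lt _ ha, ?_⟩
  conv_rhs => rw [← Nat.mod_add_div y a]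
  ring

theorem mult_eq (ha : 0 < a) (hab : a < b) (hS : ∀ s, s ∈ S ↔ ∃ x y, x * a + y * b = s) :
    mult S = a := by
  refine IsLeast.csInf_eq ⟨⟨(hS a).2 ⟨1, 0, by ring⟩, ha.ne'⟩, ?_⟩
  rintro n ⟨hn, hn0⟩
  obtain ⟨x, y, rfl⟩ := (hS n).1 hn
  rcases Nat.eq_zero_or_pos x with rfl | hx
  · rcases Nat.eq_zero_or_pos y with rfl | hy
    · simp at hn0
    · nlinarith
  · nlinarith

theorem ordS_eq (ha : 0 < a) (hab : a < b) (hcop : Nat.gcd a b = 1)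
    (hS : ∀ s, s ∈ S ↔ ∃ x y, x * a + y * b = s) {x y : ℕ} (hy : y < a) :
    ordS S (x * a + y * b) = x + y := by
  refine IsGreatest.csSup_eq ⟨?_, ?_⟩
  · refine ⟨Fin.append (fun _ => a) (fun _ => b), ?_, ?_⟩
    · refine Fin.addCases (fun i => ?_) (fun i => ?_)
      · simpa using ⟨(hS a).2 ⟨1, 0, by ring⟩, ha.ne'⟩
      · simpa using ⟨(hS b).2 ⟨0, 1, by ring⟩, (ha.trans hab).ne'⟩
    · simp [Fin.sum_univ_add]
  · rintro k ⟨c, hc, hsum⟩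
    choose p q hpq using fun i => (hS (c i)).1 (hc i).1
    have hpos : ∀ i, 1 ≤ p i + q i := by
      intro i
      by_contra! h
      have hp : p i = 0 := by omega
      have hq : q i = 0 := by omega
      exact (hc i).2 (by rw [← hpq i, hp, hq]; simp)
    have hk : k ≤ ∑ i, p i + ∑ i, q i := by
      rw [← Finset.sum_add_distrib]
      simpa using Finset.sum_le_sum fun i (_ : i ∈ Finset.univ) => hpos i
    have heq : (∑ i, p i) * a + (∑ i, q i) * b = x * a + y * b := by
      rw [← hsum, Finset.sum_mul, Finset.sum_mul, ← Finset.sum_add_distrib]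
      exact Finset.sum_congr rfl fun i _ => hpq i
    obtain ⟨t, hq, hx⟩ := exists_shift_of_eq ha hcop hy heq
    have : t * a ≤ t * b := Nat.mul_le_mul_left t hab.le
    omega

theorem mem_apery_iff (ha : 0 < a) (hcop : Nat.gcd a b = 1)
    (hS : ∀ s, s ∈ S ↔ ∃ x y, x * a + y * b = s) {m n α x y : ℕ} (hm : m ≤ a)
    (hα : α + n * a = m * b) (hy : y < a) :
    x * a + y * b ∈ apery S α ↔ y < m ∧ x + n < b := by
  constructor
  · rintro ⟨-, h⟩
    constructor
    · by_contra! hle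
      obtain ⟨d, rfl⟩ := Nat.exists_eq_add_of_le hle
      refine h ((x + n) * a + d * b) ((hS _).2 ⟨_, _, rfl⟩) ?_
      linarith
    · by_contra! hle
      obtain ⟨d, hd⟩ := Nat.exists_eq_add_of_le hle
      obtain ⟨c, rfl⟩ := Nat.exists_eq_add_of_le hm
      refine h (d * (m + c) + (y + c) * b) ((hS _).2 ⟨_, _, rfl⟩) ?_
      have : (x + n) * (m + c) = (b + d) * (m + c) := by rw [hd]
      linarith
  · rintro ⟨hym, hxn⟩
    refine ⟨(hS _).2 ⟨_, _, rfl⟩, fun s hs hsα => ?_⟩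
    obtain ⟨x', y', rfl⟩ := (hS s).1 hs
    have heq : x' * a + (y' + m) * b = (x + n) * a + y * b := by linarith
    obtain ⟨t, ht, ht'⟩ := exists_shift_of_eq ha hcop hy heq
    rcases Nat.eq_zero_or_pos t with rfl | hpos
    · omega
    · nlinarith

theorem lt_of_add_mul_eq {m n α : ℕ} (hm : m ≤ a) (h1 : 1 ≤ α)
    (hα : α + n * a = m * b) : n < b := by
  by_contra! h
  nlinarith

theorem sigmaS_eq (ha : 0 < a) (hab : a < b) (hcop : Nat.gcd a b = 1)
    (hS : ∀ s, s ∈ S ↔ ∃ x y, x * a + y * b = s) {m n α : ℕ} (hm1 : 1 ≤ m) (hm : m ≤ a)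
    (h1 : 1 ≤ α) (hα : α + n * a = m * b) :
    sigmaS S α = (m - 1) + (b - n - 1) := by
  have hn := lt_of_add_mul_eq hm h1 hα
  refine IsGreatest.csSup_eq ⟨⟨(b - n - 1) * a + (m - 1) * b, ?_, ?_⟩, ?_⟩
  · exact (mem_apery_iff ha hcop hS hm hα (by omega)).2 (by omega)
  · rw [ordS_eq ha hab hcop hS (by omega), add_comm]
  · rintro _ ⟨w, hw, rfl⟩
    obtain ⟨x, y, hy, rfl⟩ := exists_normal_form ha hS hw.1
    have := (mem_apery_iff ha hcop hS hm hα hy).1 hw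
    rw [ordS_eq ha hab hcop hS hy]
    omega

theorem exists_representation (ha : 0 < a) (hab : a < b) (hcop : Nat.gcd a b = 1) {α : ℕ}
    (h1 : 1 ≤ α) (hαa : α ≤ a) : ∃ m n, 1 ≤ m ∧ m ≤ a ∧ α + n * a = m * b := by
  rcases hαa.eq_or_lt with rfl | hlt
  · refine ⟨α, b - 1, h1, le_rfl, ?_⟩
    obtain ⟨c, rfl⟩ := Nat.exists_eq_add_of_lt hab
    simp only [Nat.add_sub_cancel]
    ring
  · obtain ⟨m, hma, hmod⟩ : ∃ m < a, b * m ≡ α [MOD a] := by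
      obtain ⟨c, hc⟩ := Nat.exists_mul_mod_eq_of_coprime α (Nat.coprime_comm.1 hcop) ha.ne'
      exact ⟨c, hc.1, by rw [Nat.ModEq, hc.2]⟩
    have hrem : (m * b) % a = α := by
      rw [mul_comm m, hmod, Nat.mod_eq_of_lt hlt]
    refine ⟨m, m * b / a, ?_, hma.le, ?_⟩
    · rcases Nat.eq_zero_or_pos m with rfl | h
      · simp at hrem
        omega
      · exact h
    · have := Nat.mod_add_div (m * b) a
      rw [hrem] at this
      linarith

theorem sigma_formula_antitone (hab : a < b) {m n α k l β : ℕ} (hm1 : 1 ≤ m) (hmk : m ≤ k)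
    (hka : k ≤ a) (hα1 : 1 ≤ α) (hβ1 : 1 ≤ β) (hβ : β ≤ a)
    (hα : α + n * a = m * b) (hkl : β + l * a = k * b) :
    (k - 1) + (b - l - 1) ≤ (m - 1) + (b - n - 1) := by
  have hn := lt_of_add_mul_eq (hmk.trans hka) hα1 hα
  have hl := lt_of_add_mul_eq hka hβ1 hkl
  obtain ⟨d, rfl⟩ := Nat.exists_eq_add_of_le hmk
  have : n + d ≤ l := by
    by_contra! h
    have h' : (l + 1) * a ≤ (n + d) * a := Nat.mul_le_mul_right a h
    have : d * a ≤ d * b := Nat.mul_le_mul_left d hab.le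
    linarith
  omega

theorem mem_Aset_iff (ha : 0 < a) (hab : a < b) (hS : ∀ s, s ∈ S ↔ ∃ x y, x * a + y * b = s)
    {u α : ℕ} (hu : u ∈ S) : α ∈ Aset S u ↔ 1 ≤ α ∧ α ≤ a ∧ u ∉ apery S α := by
  simp only [Aset, apery, mult_eq ha hab hS, Set.mem_ofPred_eq]
  grind

theorem sigmaS_self (ha : 0 < a) (hab : a < b) (hcop : Nat.gcd a b = 1)
    (hS : ∀ s, s ∈ S ↔ ∃ x y, x * a + y * b = s) : sigmaS S a = a - 1 := by
  obtain ⟨c, rfl⟩ := Nat.exists_eq_add_of_lt hab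
  rw [sigmaS_eq ha hab hcop hS (n := a + c) ha le_rfl ha (by ring)]
  omega

theorem le_sigmaS (ha : 0 < a) (hab : a < b) (hcop : Nat.gcd a b = 1)
    (hS : ∀ s, s ∈ S ↔ ∃ x y, x * a + y * b = s) {α : ℕ} (h1 : 1 ≤ α) (hαa : α ≤ a) :
    a - 1 ≤ sigmaS S α := by
  obtain ⟨m, n, hm1, hm, hα⟩ := exists_representation ha hab hcop h1 hαa
  rw [sigmaS_eq ha hab hcop hS hm1 hm h1 hα]
  obtain ⟨c, rfl⟩ := Nat.exists_eq_add_of_lt hab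
  have := sigma_formula_antitone (l := a + c) hab hm1 hm le_rfl h1 ha le_rfl hα (by ring)
  omega

theorem goto_mul_eq (ha : 0 < a) (hab : a < b) (hcop : Nat.gcd a b = 1)
    (hS : ∀ s, s ∈ S ↔ ∃ x y, x * a + y * b = s) {k : ℕ} (hk1 : 1 ≤ k) (hka : k < a) :
    goto S (k * b) = (k - 1) + (b - k * b / a - 1) ∧ k * b / a < b := by
  have hrem : 1 ≤ k * b % a := by
    by_contra! h
    have hdvd : a ∣ k * b := Nat.dvd_of_mod_eq_zero (by omega)
    have := Nat.le_of_dvd hk1 (Nat.Coprime.dvd_of_dvd_mul_right hcop hdvd)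
    omega
  have hlt := Nat.mod_lt (k * b) ha
  have hβ : k * b % a + k * b / a * a = k * b := by
    rw [mul_comm (k * b / a)]
    exact Nat.mod_add_div _ _
  have hku : k * b ∈ S := (hS _).2 ⟨0, k, by ring⟩
  have hap {m n α : ℕ} (hm : m ≤ a) (hα : α + n * a = m * b) :
      k * b ∈ apery S α ↔ k < m ∧ n < b := by
    simpa using mem_apery_iff (x := 0) ha hcop hS hm hα hka
  refine ⟨IsLeast.csInf_eq ⟨⟨k * b % a, ?_, ?_⟩, ?_⟩, lt_of_add_mul_eq hka.le hrem hβ⟩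
  · rw [mem_Aset_iff ha hab hS hku, hap hka.le hβ]
    omega
  · exact sigmaS_eq ha hab hcop hS hk1 hka.le hrem hβ
  · rintro _ ⟨α, hαmem, rfl⟩
    obtain ⟨hα1, hαa, hnot⟩ := (mem_Aset_iff ha hab hS hku).1 hαmem
    obtain ⟨m, n, hm1, hm, hα⟩ := exists_representation ha hab hcop hα1 hαa
    rw [hap hm hα] at hnot
    have hn := lt_of_add_mul_eq hm hα1 hα
    rw [sigmaS_eq ha hab hcop hS hm1 hm hα1 hα]
    exact sigma_formula_antitone hab hm1 (by omega) hka.le hα1 hrem hlt.le hα hβ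

theorem goto_add_eq (ha : 0 < a) (hab : a < b) (hcop : Nat.gcd a b = 1)
    (hS : ∀ s, s ∈ S ↔ ∃ x y, x * a + y * b = s) {s : ℕ} (hs : s ∈ S) :
    goto S (s + a) = a - 1 := by
  refine IsLeast.csInf_eq ⟨⟨a, ?_, sigmaS_self ha hab hcop hS⟩, ?_⟩
  · exact ⟨ha, (mult_eq ha hab hS).ge, s, hs, rfl⟩
  · rintro _ ⟨α, ⟨h1, hαa, -⟩, rfl⟩
    exact le_sigmaS ha hab hcop hS h1 (hαa.trans (mult_eq ha hab hS).le)

theorem eq_mul_or_eq_add (ha : 0 < a) (hS : ∀ s, s ∈ S ↔ ∃ x y, x * a + y * b = s) {u : ℕ}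
    (hu : u ∈ S) (hu0 : u ≠ 0) :
    (∃ k, 1 ≤ k ∧ k ≤ a - 1 ∧ u = k * b) ∨ ∃ s ∈ S, u = s + a := by
  obtain ⟨x, y, hy, rfl⟩ := exists_normal_form ha hS hu
  rcases x with _ | x
  · refine Or.inl ⟨y, ?_, by omega, by ring⟩
    rcases Nat.eq_zero_or_pos y with rfl | h
    · simp at hu0
    · exact h
  · exact Or.inr ⟨x * a + y * b, (hS _).2 ⟨_, _, rfl⟩, by ring⟩

theorem le_goto (ha : 0 < a) (hab : a < b) (hcop : Nat.gcd a b = 1)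
    (hS : ∀ s, s ∈ S ↔ ∃ x y, x * a + y * b = s) {u : ℕ} (hu : u ∈ S) (hu0 : u ≠ 0) :
    a - 1 ≤ goto S u := by
  rcases eq_mul_or_eq_add ha hS hu hu0 with ⟨k, hk1, hka, rfl⟩ | ⟨s, hs, rfl⟩
  · obtain ⟨hg, hlt⟩ := goto_mul_eq ha hab hcop hS hk1 (by omega : k < a)
    rw [hg]
    obtain ⟨c, rfl⟩ := Nat.exists_eq_add_of_lt hab
    have : k * (a + c + 1) / a < k + c + 1 := by
      rw [Nat.div_lt_iff_lt_mul ha]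
      have : k * (c + 1) < a * (c + 1) := Nat.mul_lt_mul_of_pos_right (by omega) (by omega)
      linarith
    omega
  · exact (goto_add_eq ha hab hcop hS hs).ge

end TwoGenerators

/-- Goto numbers for `S = ⟨a₁, a₂⟩` of embedding dimension 2. -/
theorem statement19 (a1 a2 : ℕ) (h1 : 2 ≤ a1) (h12 : a1 < a2)
    (hcop : Nat.gcd a1 a2 = 1)
    (S : Set ℕ) (hSdef : S = (AddSubmonoid.closure ({a1, a2} : Set ℕ) : Set ℕ)) :
    (∀ k, 1 ≤ k → k ≤ a1 - 1 →
      (goto S (k * a2) : ℤ) = (a2 : ℤ) + (k : ℤ) - 2 - ((k * a2) / a1 : ℕ)) ∧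
    (∀ u ∈ S, u ≠ 0 → (¬ ∃ k, 1 ≤ k ∧ k ≤ a1 - 1 ∧ u = k * a2) →
      goto S u = a1 - 1) ∧
    tau S = a1 - 1 := by
  have ha : 0 < a1 := by omega
  have hS : ∀ s, s ∈ S ↔ ∃ x y, x * a1 + y * a2 = s := by
    intro s
    rw [hSdef, SetLike.mem_coe, AddSubmonoid.mem_closure_pair]
    simp only [smul_eq_mul]
  have h0 : 0 ∈ S := (hS 0).2 ⟨0, 0, by ring⟩
  have hmem : a1 ∈ S := (hS a1).2 ⟨1, 0, by ring⟩
  refine ⟨fun k hk1 hka => ?_, fun u hu hu0 hk => ?_, ?_⟩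
  · obtain ⟨hg, hlt⟩ := goto_mul_eq ha h12 hcop hS hk1 (by omega : k < a1)
    rw [hg]
    omega
  · obtain ⟨s, hs, rfl⟩ := (eq_mul_or_eq_add ha hS hu hu0).resolve_left hk
    exact goto_add_eq ha h12 hcop hS hs
  · refine IsLeast.csInf_eq ⟨⟨a1, ⟨hmem, ha.ne'⟩, ?_⟩, ?_⟩
    · simpa using goto_add_eq ha h12 hcop hS h0
    · rintro _ ⟨u, ⟨hu, hu0⟩, rfl⟩
      exact le_goto ha h12 hcop hS hu hu0

end GotoNS
end
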